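/- Let n be a positive integer, let Θ be a real skew-symmetric n×n matrix, and let f, g : ℝⁿ → ℂ be Schwartz functions. Then the function (t, z) ↦ f(t + Θz)·(∫_{ℝⁿ} g(t + s)·e^{2πi⟨z,s⟩} ds) is Lebesgue integrable on ℝⁿ × ℝⁿ, and ∫_{ℝⁿ} ∫_{ℝⁿ} f(t + Θz)·(∫_{ℝⁿ} g(t + s)·e^{2πi⟨z,s⟩} ds) dz dt = ∫_{ℝⁿ} f(t)·g(t) dt. -/

import Mathlib

open MeasureTheory

open scoped FourierTransform SchwartzMap

/-- The inverse Fourier transform of a Schwartz function on `ℝⁿ`, in coordinates, is integrable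
and the Fourier transform inverts it. -/
theorem SchwartzMap.exists_integrable_fourierInv_pi {n : ℕ} (g : SchwartzMap (Fin n → ℝ) ℂ) :
    ∃ G : (Fin n → ℝ) → ℂ, Integrable G ∧
      (∀ z, G z = ∫ s : Fin n → ℝ, g s *
        Complex.exp (2 * Real.pi * Complex.I * ((∑ i, z i * s i : ℝ) : ℂ))) ∧
      ∀ t, ∫ z : Fin n → ℝ,
        Complex.exp (-(2 * Real.pi * Complex.I * ((∑ i, z i * t i : ℝ) : ℂ))) * G z = g t := by
  let L := PiLp.continuousLinearEquiv 2 ℝ (fun _ : Fin n => ℝ)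
  let g' : 𝓢(EuclideanSpace ℝ (Fin n), ℂ) := SchwartzMap.compCLMOfContinuousLinearEquiv ℂ L g
  have hvol := PiLp.volume_preserving_toLp (Fin n)
  have hemb : MeasurableEmbedding (WithLp.toLp 2 : (Fin n → ℝ) → EuclideanSpace ℝ (Fin n)) :=
    (MeasurableEquiv.toLp 2 (Fin n → ℝ)).measurableEmbedding
  refine ⟨fun z => (𝓕⁻ g') (WithLp.toLp 2 z), ?_, fun z => ?_, fun t => ?_⟩
  · exact hvol.integrable_comp_of_integrable (𝓕⁻ g').integrable
  · beta_reduce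
    rw [SchwartzMap.fourierInv_coe, Real.fourierInv_eq', ← hvol.integral_comp hemb]
    refine integral_congr_ae (.of_forall fun s => ?_)
    simp only [PiLp.inner_apply, smul_eq_mul, RCLike.inner_apply, conj_trivial]
    rw [mul_comm]
    refine congrArg₂ (· * ·) rfl (congrArg Complex.exp ?_)
    push_cast
    ring
  · have h : 𝓕 (𝓕⁻ g') (WithLp.toLp 2 t) = g t := by
      rw [FourierTransform.fourier_fourierInv_eq]
      rfl
    rw [← h, SchwartzMap.fourier_coe, Real.fourier_eq', ← hvol.integral_comp hemb]
    refine integral_congr_ae (.of_forall fun s => ?_)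
    simp only [PiLp.inner_apply, smul_eq_mul, RCLike.inner_apply, conj_trivial]
    congr 2
    push_cast
    simp only [mul_comm (t _ : ℂ)]
    ring

/-- The shear `(t, z) ↦ (t + φ z, z)` preserves the product measure. -/
theorem measurePreserving_shear_add {E F : Type*} [MeasurableSpace E] [MeasurableSpace F]
    [AddGroup E] [MeasurableAdd₂ E] (μ : Measure E) (ν : Measure F) [SFinite μ] [SFinite ν]
    [μ.IsAddRightInvariant] {φ : F → E} (hφ : Measurable φ) :
    MeasurePreserving (fun p : E × F => (p.1 + φ p.2, p.2)) (μ.prod ν) (μ.prod ν) := by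
  have h : MeasurePreserving (fun p : F × E => (p.1, p.2 + φ p.1)) (ν.prod μ) (ν.prod μ) :=
    (MeasurePreserving.id ν).skew_product (g := fun z t => t + φ z) (by fun_prop)
      (.of_forall fun z => map_add_right_eq_self μ (φ z))
  exact (Measure.measurePreserving_swap.comp h).comp Measure.measurePreserving_swap

/-- A skew-symmetric matrix has vanishing quadratic form. -/
theorem Matrix.dotProduct_mulVec_self_of_transpose_eq_neg {n : ℕ} {Θ : Matrix (Fin n) (Fin n) ℝ}
    (hΘ : Θ.transpose = -Θ) (z : Fin n → ℝ) : z ⬝ᵥ Θ.mulVec z = 0 := by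
  have h : z ⬝ᵥ Θ.mulVec z = -(z ⬝ᵥ Θ.mulVec z) := by
    conv_lhs => rw [Matrix.dotProduct_mulVec, ← Matrix.mulVec_transpose, hΘ, Matrix.neg_mulVec,
      neg_dotProduct, dotProduct_comm]
  linarith

/-- The Lebesgue integral is a trace for the Rieffel-deformed product: for Schwartz
functions `f, g` on `ℝⁿ` and a real skew-symmetric matrix `Θ`, the function
`(t, z) ↦ f(t + Θz)·∫ g(t + s)e^{2πi⟨z,s⟩} ds` is integrable on `ℝⁿ × ℝⁿ` and
`∫∫ f(t + Θz)(∫ g(t + s)e^{2πi⟨z,s⟩} ds) dz dt = ∫ f·g`. -/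
theorem stmt_11 {n : ℕ} (hn : 0 < n) (Θ : Matrix (Fin n) (Fin n) ℝ)
    (hΘ : Θ.transpose = -Θ)
    (f g : SchwartzMap (Fin n → ℝ) ℂ) :
    Integrable
      (fun p : (Fin n → ℝ) × (Fin n → ℝ) =>
        f (p.1 + Θ.mulVec p.2) *
          ∫ s : Fin n → ℝ, g (p.1 + s) *
            Complex.exp (2 * Real.pi * Complex.I * ((∑ i, p.2 i * s i : ℝ) : ℂ))) ∧
    (∫ t : Fin n → ℝ, ∫ z : Fin n → ℝ,
        f (t + Θ.mulVec z) *
          ∫ s : Fin n → ℝ, g (t + s) *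
            Complex.exp (2 * Real.pi * Complex.I * ((∑ i, z i * s i : ℝ) : ℂ)))
      = ∫ t : Fin n → ℝ, f t * g t := by
  obtain ⟨G, hG, hGz, hGt⟩ := g.exists_integrable_fourierInv_pi
  let K : (Fin n → ℝ) × (Fin n → ℝ) → ℂ := fun p =>
    Complex.exp (-(2 * Real.pi * Complex.I * ((∑ i, p.2 i * p.1 i : ℝ) : ℂ))) * (f p.1 * G p.2)
  have hK : Integrable K := by
    refine (f.integrable.mul_prod hG).bdd_mul (c := 1)
      (Continuous.aestronglyMeasurable (by fun_prop)) (.of_forall fun p => le_of_eq ?_)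
    rw [Complex.norm_exp]
    simp
  have hshear := measurePreserving_shear_add (volume : Measure (Fin n → ℝ))
    (volume : Measure (Fin n → ℝ)) (φ := Θ.mulVec)
    (Continuous.measurable (continuous_const.matrix_mulVec continuous_id))
  have htrans (t z : Fin n → ℝ) : (∫ s : Fin n → ℝ, g (t + s) *
      Complex.exp (2 * Real.pi * Complex.I * ((∑ i, z i * s i : ℝ) : ℂ))) =
      Complex.exp (-(2 * Real.pi * Complex.I * ((∑ i, z i * t i : ℝ) : ℂ))) * G z := by
    rw [hGz, ← integral_const_mul]
    refine Eq.trans ?_ (integral_add_left_eq_self (fun s : Fin n → ℝ =>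
      Complex.exp (-(2 * Real.pi * Complex.I * ((∑ i, z i * t i : ℝ) : ℂ))) * (g s *
        Complex.exp (2 * Real.pi * Complex.I * ((∑ i, z i * s i : ℝ) : ℂ)))) t)
    refine integral_congr_ae (.of_forall fun s => ?_)
    have hsum : ∑ i, z i * (t + s) i = ∑ i, z i * t i + ∑ i, z i * s i := by
      simp only [Pi.add_apply, mul_add, Finset.sum_add_distrib]
    beta_reduce
    rw [mul_left_comm, ← Complex.exp_add, hsum]
    refine congrArg (g (t + s) * Complex.exp ·) ?_
    push_cast
    ring
  have hcomp (t z : Fin n → ℝ) : f (t + Θ.mulVec z) * (∫ s : Fin n → ℝ, g (t + s) *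
      Complex.exp (2 * Real.pi * Complex.I * ((∑ i, z i * s i : ℝ) : ℂ))) =
      K (t + Θ.mulVec z, z) := by
    have hz : ∑ i, z i * Θ.mulVec z i = 0 :=
      Matrix.dotProduct_mulVec_self_of_transpose_eq_neg hΘ z
    have hsum : ∑ i, z i * (t + Θ.mulVec z) i = ∑ i, z i * t i := by
      simp only [Pi.add_apply, mul_add, Finset.sum_add_distrib, hz, add_zero]
    simp only [K]
    rw [htrans, hsum]
    ring
  simp only [hcomp]
  have hint := hshear.integrable_comp_of_integrable hK
  refine ⟨hint, ?_⟩
  calc ∫ t, ∫ z, K (t + Θ.mulVec z, z)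
      = ∫ p : (Fin n → ℝ) × (Fin n → ℝ), K (p.1 + Θ.mulVec p.2, p.2) :=
        (integral_prod _ hint).symm
    _ = ∫ p, K p := by
        conv_rhs => rw [Measure.volume_eq_prod, ← hshear.map_eq]
        exact (integral_map hshear.measurable.aemeasurable
          (hshear.map_eq ▸ hK.aestronglyMeasurable)).symm
    _ = ∫ t, ∫ z, K (t, z) := integral_prod _ hK
    _ = ∫ t, f t * g t := by
        refine integral_congr_ae (.of_forall fun t => ?_)
        simp only [K, mul_left_comm _ (f t)]
        rw [integral_const_mul, hGt]
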